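/- For every formula F, the sequents ∃yIx[F,x=y] ⇒ Ix[F,∃!x] and Ix[F,∃!x] ⇒ ∃yIx[F,x=y] are both provable in GPFL=^I (where y is a variable not occurring in F); that is, 'Something is identical to the F' is equivalent to 'The F exists' in GPFL=^I. -/

import Mathlib

/-!
Deep embedding of the language of classical positive free logic with the
binary quantifier `I` for definite descriptions (`Ix[F,G]`, "the F is G"),
and of Indrzejczak's sequent calculus GPFL= extended by the rules for `I`
(the system GPFL=^I of Kürbis).  Bound variables are de Bruijn indices,
free variables are "parameters" (natural numbers).
-/

/-- A first-order signature: function symbols and predicate symbols with arities. -/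
structure Sig where
  Fn : Type
  fnAr : Fn → ℕ
  Pr : Type
  prAr : Pr → ℕ

/-- Terms: parameters, constants, (de Bruijn) bound variables and function terms. -/
inductive Tm (σ : Sig) : Type
  | par : ℕ → Tm σ
  | const : ℕ → Tm σ
  | bvar : ℕ → Tm σ
  | func : (f : σ.Fn) → (Fin (σ.fnAr f) → Tm σ) → Tm σ

namespace Tm

variable {σ : Sig}

/-- Lift (shift up by one) the bound variables `≥ c`. -/
def lift (c : ℕ) : Tm σ → Tm σ
  | par a => par a
  | const k => const k
  | bvar n => if n < c then bvar n else bvar (n + 1)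
  | func f ts => func f fun i => (ts i).lift c

/-- Substitute the term `u` for the bound variable `k`. -/
def inst (k : ℕ) (u : Tm σ) : Tm σ → Tm σ
  | par a => par a
  | const c => const c
  | bvar n => if n = k then u else if k < n then bvar (n - 1) else bvar n
  | func f ts => func f fun i => inst k u (ts i)

/-- Substitute the term `u` for the parameter `a`. -/
def substPar (a : ℕ) (u : Tm σ) : Tm σ → Tm σ
  | par b => if b = a then u else par b
  | const c => const c
  | bvar n => bvar n
  | func f ts => func f fun i => substPar a u (ts i)

/-- The set of parameters occurring in a term. -/
def pars : Tm σ → Set ℕ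
  | par a => {a}
  | const _ => ∅
  | bvar _ => ∅
  | func _ ts => ⋃ i, (ts i).pars

/-- A term is `ClosedB` if it contains no (dangling) bound variables; genuine
terms of the language are of this kind, and such a term is automatically
free for any variable in any formula. -/
def ClosedB : Tm σ → Prop
  | par _ => True
  | const _ => True
  | bvar _ => False
  | func _ ts => ∀ i, (ts i).ClosedB

end Tm

/-- Formulas, including the existence predicate `ext t` (`∃!t`) and the binary
quantifier `iq F G` (`Ix[F,G]`), which binds the de Bruijn variable `0` in
both `F` and `G`. -/
inductive Fml (σ : Sig) : Type
  | atom : (p : σ.Pr) → (Fin (σ.prAr p) → Tm σ) → Fml σ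
  | eq : Tm σ → Tm σ → Fml σ
  | ext : Tm σ → Fml σ
  | neg : Fml σ → Fml σ
  | conj : Fml σ → Fml σ → Fml σ
  | disj : Fml σ → Fml σ → Fml σ
  | imp : Fml σ → Fml σ → Fml σ
  | all : Fml σ → Fml σ
  | ex : Fml σ → Fml σ
  | iq : Fml σ → Fml σ → Fml σ

namespace Fml

variable {σ : Sig}

/-- Lift (shift up by one) the bound variables `≥ c`. -/
def lift (c : ℕ) : Fml σ → Fml σ
  | atom p ts => atom p fun i => (ts i).lift c
  | eq t s => eq (t.lift c) (s.lift c)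
  | ext t => ext (t.lift c)
  | neg A => neg (A.lift c)
  | conj A B => conj (A.lift c) (B.lift c)
  | disj A B => disj (A.lift c) (B.lift c)
  | imp A B => imp (A.lift c) (B.lift c)
  | all A => all (A.lift (c + 1))
  | ex A => ex (A.lift (c + 1))
  | iq F G => iq (F.lift (c + 1)) (G.lift (c + 1))

/-- Substitute the term `u` for the bound variable `k`. -/
def inst (k : ℕ) (u : Tm σ) : Fml σ → Fml σ
  | atom p ts => atom p fun i => Tm.inst k u (ts i)
  | eq t s => eq (Tm.inst k u t) (Tm.inst k u s)
  | ext t => ext (Tm.inst k u t)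
  | neg A => neg (A.inst k u)
  | conj A B => conj (A.inst k u) (B.inst k u)
  | disj A B => disj (A.inst k u) (B.inst k u)
  | imp A B => imp (A.inst k u) (B.inst k u)
  | all A => all (A.inst (k + 1) (u.lift 0))
  | ex A => ex (A.inst (k + 1) (u.lift 0))
  | iq F G => iq (F.inst (k + 1) (u.lift 0)) (G.inst (k + 1) (u.lift 0))

/-- `A.inst0 t` is `A[t/x]`: the result of substituting `t` for the
outermost bound variable `x` (de Bruijn index 0) of `A`. -/
def inst0 (A : Fml σ) (u : Tm σ) : Fml σ := A.inst 0 u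

/-- Substitute the term `u` for the parameter `a`. -/
def substPar (a : ℕ) (u : Tm σ) : Fml σ → Fml σ
  | atom p ts => atom p fun i => Tm.substPar a u (ts i)
  | eq t s => eq (Tm.substPar a u t) (Tm.substPar a u s)
  | ext t => ext (Tm.substPar a u t)
  | neg A => neg (A.substPar a u)
  | conj A B => conj (A.substPar a u) (B.substPar a u)
  | disj A B => disj (A.substPar a u) (B.substPar a u)
  | imp A B => imp (A.substPar a u) (B.substPar a u)
  | all A => all (A.substPar a u)
  | ex A => ex (A.substPar a u)
  | iq F G => iq (F.substPar a u) (G.substPar a u)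

/-- The set of parameters occurring in a formula. -/
def pars : Fml σ → Set ℕ
  | atom _ ts => ⋃ i, (ts i).pars
  | eq t s => t.pars ∪ s.pars
  | ext t => t.pars
  | neg A => A.pars
  | conj A B => A.pars ∪ B.pars
  | disj A B => A.pars ∪ B.pars
  | imp A B => A.pars ∪ B.pars
  | all A => A.pars
  | ex A => A.pars
  | iq F G => F.pars ∪ G.pars

/-- The degree of a formula: the number of logical operators occurring in it;
`∃!t` counts as atomic (degree 0). -/
def deg : Fml σ → ℕ
  | atom _ _ => 0
  | eq _ _ => 0
  | ext _ => 0
  | neg A => A.deg + 1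
  | conj A B => A.deg + B.deg + 1
  | disj A B => A.deg + B.deg + 1
  | imp A B => A.deg + B.deg + 1
  | all A => A.deg + 1
  | ex A => A.deg + 1
  | iq F G => F.deg + G.deg + 1

/-- Atomic formulas: predications, identities and existence statements. -/
def Atomic : Fml σ → Prop
  | atom _ _ => True
  | eq _ _ => True
  | ext _ => True
  | _ => False

/-- `A ↔ B` abbreviates `(A → B) ∧ (B → A)`. -/
def iff (A B : Fml σ) : Fml σ := conj (imp A B) (imp B A)

/-- The formula `∃!x` (with `x` the variable bound by the surrounding
binder), used as the second argument of `I` in `Ix[F, ∃!x]`. -/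
def exG : Fml σ := ext (Tm.bvar 0)

end Fml

/-- The parameter `a` does not occur in any formula of `Γ`. -/
def FreshM {σ : Sig} (a : ℕ) (Γ : Multiset (Fml σ)) : Prop := ∀ B ∈ Γ, a ∉ B.pars

/-- Proof trees of the sequent calculus GPFL=^I: Indrzejczak's calculus GPFL=
for classical positive free logic with identity, extended by Kürbis' rules
(RI), (LI¹), (LI²), (LI³), (LI⁴), (LI⁵) for the binary quantifier `I`.
Sequents relate finite multisets of formulas.  The parameter `P` constrains
the cut formulas: every cut formula of the proof must satisfy `P`
(so `P := fun _ => True` puts no constraint, and `P := fun _ => False` means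
cut-free).  The last index is the height of the proof tree: the number of
nodes of its longest branch. -/
inductive Prf (σ : Sig) (P : Fml σ → Prop) :
    Multiset (Fml σ) → Multiset (Fml σ) → ℕ → Type
  | ax (A : Fml σ) : Prf σ P {A} {A} 1
  | cut {Γ Θ Δ Λ : Multiset (Fml σ)} {m n : ℕ} (A : Fml σ) :
      Prf σ P Γ (A ::ₘ Θ) m → Prf σ P (A ::ₘ Δ) Λ n → P A →
      Prf σ P (Γ + Δ) (Θ + Λ) (max m n + 1)
  | lw {Γ Δ : Multiset (Fml σ)} {n : ℕ} (A : Fml σ) :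
      Prf σ P Γ Δ n → Prf σ P (A ::ₘ Γ) Δ (n + 1)
  | rw {Γ Δ : Multiset (Fml σ)} {n : ℕ} (A : Fml σ) :
      Prf σ P Γ Δ n → Prf σ P Γ (A ::ₘ Δ) (n + 1)
  | lc {Γ Δ : Multiset (Fml σ)} {n : ℕ} (A : Fml σ) :
      Prf σ P (A ::ₘ A ::ₘ Γ) Δ n → Prf σ P (A ::ₘ Γ) Δ (n + 1)
  | rc {Γ Δ : Multiset (Fml σ)} {n : ℕ} (A : Fml σ) :
      Prf σ P Γ (A ::ₘ A ::ₘ Δ) n → Prf σ P Γ (A ::ₘ Δ) (n + 1)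
  | lneg {Γ Δ : Multiset (Fml σ)} {n : ℕ} (A : Fml σ) :
      Prf σ P Γ (A ::ₘ Δ) n → Prf σ P (A.neg ::ₘ Γ) Δ (n + 1)
  | rneg {Γ Δ : Multiset (Fml σ)} {n : ℕ} (A : Fml σ) :
      Prf σ P (A ::ₘ Γ) Δ n → Prf σ P Γ (A.neg ::ₘ Δ) (n + 1)
  | land {Γ Δ : Multiset (Fml σ)} {n : ℕ} (A B : Fml σ) :
      Prf σ P (A ::ₘ B ::ₘ Γ) Δ n → Prf σ P ((A.conj B) ::ₘ Γ) Δ (n + 1)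
  | rand {Γ Δ : Multiset (Fml σ)} {m n : ℕ} (A B : Fml σ) :
      Prf σ P Γ (A ::ₘ Δ) m → Prf σ P Γ (B ::ₘ Δ) n →
      Prf σ P Γ ((A.conj B) ::ₘ Δ) (max m n + 1)
  | lor {Γ Δ : Multiset (Fml σ)} {m n : ℕ} (A B : Fml σ) :
      Prf σ P (A ::ₘ Γ) Δ m → Prf σ P (B ::ₘ Γ) Δ n →
      Prf σ P ((A.disj B) ::ₘ Γ) Δ (max m n + 1)
  | ror {Γ Δ : Multiset (Fml σ)} {n : ℕ} (A B : Fml σ) :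
      Prf σ P Γ (A ::ₘ B ::ₘ Δ) n → Prf σ P Γ ((A.disj B) ::ₘ Δ) (n + 1)
  | limp {Γ Δ : Multiset (Fml σ)} {m n : ℕ} (A B : Fml σ) :
      Prf σ P Γ (A ::ₘ Δ) m → Prf σ P (B ::ₘ Γ) Δ n →
      Prf σ P ((A.imp B) ::ₘ Γ) Δ (max m n + 1)
  | rimp {Γ Δ : Multiset (Fml σ)} {n : ℕ} (A B : Fml σ) :
      Prf σ P (A ::ₘ Γ) (B ::ₘ Δ) n → Prf σ P Γ ((A.imp B) ::ₘ Δ) (n + 1)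
  | lall {Γ Δ : Multiset (Fml σ)} {n : ℕ} (A : Fml σ) (t : Tm σ) :
      Prf σ P ((A.inst0 t) ::ₘ Γ) Δ n →
      Prf σ P ((Fml.ext t) ::ₘ (Fml.all A) ::ₘ Γ) Δ (n + 1)
  | rall {Γ Δ : Multiset (Fml σ)} {n : ℕ} (A : Fml σ) (a : ℕ) :
      FreshM a Γ → FreshM a Δ → a ∉ A.pars →
      Prf σ P ((Fml.ext (.par a)) ::ₘ Γ) ((A.inst0 (.par a)) ::ₘ Δ) n →
      Prf σ P Γ ((Fml.all A) ::ₘ Δ) (n + 1)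
  | lex {Γ Δ : Multiset (Fml σ)} {n : ℕ} (A : Fml σ) (a : ℕ) :
      FreshM a Γ → FreshM a Δ → a ∉ A.pars →
      Prf σ P ((Fml.ext (.par a)) ::ₘ (A.inst0 (.par a)) ::ₘ Γ) Δ n →
      Prf σ P ((Fml.ex A) ::ₘ Γ) Δ (n + 1)
  | rex {Γ Δ : Multiset (Fml σ)} {n : ℕ} (A : Fml σ) (t : Tm σ) :
      Prf σ P Γ ((A.inst0 t) ::ₘ Δ) n →
      Prf σ P ((Fml.ext t) ::ₘ Γ) ((Fml.ex A) ::ₘ Δ) (n + 1)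
  | eqI {Γ Δ : Multiset (Fml σ)} {n : ℕ} (A : Fml σ) (t₁ t₂ : Tm σ) :
      A.Atomic →
      Prf σ P ((A.inst0 t₂) ::ₘ Γ) Δ n →
      Prf σ P ((Fml.eq t₁ t₂) ::ₘ (A.inst0 t₁) ::ₘ Γ) Δ (n + 1)
  | eqE {Γ Δ : Multiset (Fml σ)} {n : ℕ} (t : Tm σ) :
      Prf σ P ((Fml.eq t t) ::ₘ Γ) Δ n → Prf σ P Γ Δ (n + 1)
  | ri {Γ Δ : Multiset (Fml σ)} {n₁ n₂ n₃ n₄ : ℕ} (F G : Fml σ) (t : Tm σ) (a : ℕ) :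
      FreshM a Γ → FreshM a Δ → a ∉ F.pars → a ∉ G.pars →
      Prf σ P Γ ((F.inst0 t) ::ₘ Δ) n₁ →
      Prf σ P Γ ((G.inst0 t) ::ₘ Δ) n₂ →
      Prf σ P Γ ((Fml.ext t) ::ₘ Δ) n₃ →
      Prf σ P ((Fml.ext (.par a)) ::ₘ (F.inst0 (.par a)) ::ₘ Γ)
        ((Fml.eq (.par a) t) ::ₘ Δ) n₄ →
      Prf σ P Γ ((Fml.iq F G) ::ₘ Δ) (max (max n₁ n₂) (max n₃ n₄) + 1)
  | li1 {Γ Δ : Multiset (Fml σ)} {n₁ n₂ n₃ n₄ : ℕ} (F G : Fml σ) (t : Tm σ) (a b : ℕ) :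
      FreshM a Γ → FreshM a Δ → a ∉ F.pars → a ∉ G.pars →
      FreshM b Γ → FreshM b Δ → b ∉ F.pars → b ∉ G.pars →
      Prf σ P Γ ((F.inst0 t) ::ₘ Δ) n₁ →
      Prf σ P Γ ((Fml.ext t) ::ₘ Δ) n₂ →
      Prf σ P ((F.inst0 (.par a)) ::ₘ (Fml.ext (.par a)) ::ₘ Γ)
        ((Fml.eq (.par a) t) ::ₘ Δ) n₃ →
      Prf σ P ((F.inst0 (.par b)) ::ₘ (G.inst0 (.par b)) ::ₘ (Fml.ext (.par b)) ::ₘ Γ) Δ n₄ →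
      Prf σ P ((Fml.iq F G) ::ₘ Γ) Δ (max (max n₁ n₂) (max n₃ n₄) + 1)
  | li2 {Γ Δ : Multiset (Fml σ)} {n₁ n₂ n₃ n₄ n₅ : ℕ} (F A : Fml σ) (t₁ t₂ : Tm σ) :
      A.Atomic →
      Prf σ P Γ ((F.inst0 t₁) ::ₘ Δ) n₁ →
      Prf σ P Γ ((F.inst0 t₂) ::ₘ Δ) n₂ →
      Prf σ P Γ ((Fml.ext t₁) ::ₘ Δ) n₃ →
      Prf σ P Γ ((Fml.ext t₂) ::ₘ Δ) n₄ →
      Prf σ P Γ ((A.inst0 t₂) ::ₘ Δ) n₅ →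
      Prf σ P ((Fml.iq F Fml.exG) ::ₘ Γ) ((A.inst0 t₁) ::ₘ Δ)
        (max (max (max n₁ n₂) (max n₃ n₄)) n₅ + 1)
  | li3 {Γ Δ : Multiset (Fml σ)} {n : ℕ} (F : Fml σ) (a : ℕ) :
      FreshM a Γ → FreshM a Δ → a ∉ F.pars →
      Prf σ P ((F.inst0 (.par a)) ::ₘ (Fml.ext (.par a)) ::ₘ Γ) Δ n →
      Prf σ P ((Fml.iq F Fml.exG) ::ₘ Γ) Δ (n + 1)
  | li4 {Γ Δ : Multiset (Fml σ)} {n₁ n₂ n₃ n₄ : ℕ} (F A : Fml σ) (t₁ t₂ : Tm σ) :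
      A.Atomic →
      Prf σ P Γ ((F.inst0 t₁) ::ₘ Δ) n₁ →
      Prf σ P Γ ((Fml.ext t₁) ::ₘ Δ) n₂ →
      Prf σ P Γ ((Fml.ext t₂) ::ₘ Δ) n₃ →
      Prf σ P Γ ((A.inst0 t₂) ::ₘ Δ) n₄ →
      Prf σ P ((Fml.iq F (Fml.eq (.bvar 0) (t₂.lift 0))) ::ₘ Γ) ((A.inst0 t₁) ::ₘ Δ)
        (max (max n₁ n₂) (max n₃ n₄) + 1)
  | li5 {Γ Δ : Multiset (Fml σ)} {m n : ℕ} (F : Fml σ) (t : Tm σ) (a : ℕ) :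
      FreshM a Γ → FreshM a Δ → a ∉ F.pars → a ∉ t.pars →
      Prf σ P Γ ((Fml.ext t) ::ₘ Δ) m →
      Prf σ P ((F.inst0 (.par a)) ::ₘ (Fml.ext (.par a)) ::ₘ Γ) Δ n →
      Prf σ P ((Fml.iq F (Fml.eq (.bvar 0) (t.lift 0))) ::ₘ Γ) Δ (max m n + 1)

/-- Provability in GPFL=^I (cuts unrestricted). -/
def Prov (σ : Sig) (Γ Δ : Multiset (Fml σ)) : Prop :=
  ∃ n, Nonempty (Prf σ (fun _ => True) Γ Δ n)

/-- The formula `∃y Ix[F, x = y]`, "something is identical to the F"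
(`y` is the variable bound by the outer existential quantifier, so it does
not occur in `F`). -/
def exIdF {σ : Sig} (F : Fml σ) : Fml σ :=
  Fml.ex (Fml.iq (F.lift 1) (Fml.eq (.bvar 0) (.bvar 1)))

namespace Tm

variable {σ : Sig}

theorem inst_lift (k : ℕ) (u : Tm σ) (t : Tm σ) : inst k u (t.lift k) = t := by
  induction t with
  | par a => rfl
  | const c => rfl
  | bvar n => unfold lift; split_ifs <;> simp only [inst] <;> split_ifs <;> first | rfl | omega
  | func f ts ih => simp [lift, inst, ih]

theorem finite_pars (t : Tm σ) : t.pars.Finite := by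
  induction t with
  | par a => exact Set.finite_singleton a
  | const c => exact Set.finite_empty
  | bvar n => exact Set.finite_empty
  | func f ts ih => exact Set.finite_iUnion ih

end Tm

namespace Fml

variable {σ : Sig}

theorem inst_lift (A : Fml σ) : ∀ (k : ℕ) (u : Tm σ), (A.lift k).inst k u = A := by
  induction A <;> simp_all [lift, inst, Tm.inst_lift]

theorem finite_pars (A : Fml σ) : A.pars.Finite := by
  induction A with
  | atom p ts => exact Set.finite_iUnion fun i => (ts i).finite_pars
  | eq t s => exact t.finite_pars.union s.finite_pars
  | ext t => exact t.finite_pars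
  | neg A ih | all A ih | ex A ih => exact ih
  | conj A B ihA ihB | disj A B ihA ihB | imp A B ihA ihB | iq A B ihA ihB => exact ihA.union ihB

end Fml

/-- The formula `x = t` (with `x` the variable bound by the surrounding binder), used as the second
argument of `I` in `Ix[F, x = t]`. -/
abbrev Fml.eqG {σ : Sig} (t : Tm σ) : Fml σ := Fml.eq (.bvar 0) (t.lift 0)

theorem exists_freshM {σ : Sig} (Γ : Multiset (Fml σ)) : ∃ a, FreshM a Γ := by
  have hfin : (⋃ B ∈ {B | B ∈ Γ}, B.pars).Finite :=
    Set.Finite.biUnion Γ.finite_toSet fun B _ => B.finite_pars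
  obtain ⟨a, ha⟩ := hfin.exists_notMem
  exact ⟨a, fun B hB h => ha (Set.mem_biUnion hB h)⟩

namespace Prov

variable {σ : Sig} {Γ Δ : Multiset (Fml σ)}

theorem weaken_left (A : Fml σ) : Prov σ Γ Δ → Prov σ (A ::ₘ Γ) Δ :=
  fun ⟨_, ⟨p⟩⟩ => ⟨_, ⟨.lw A p⟩⟩

theorem weaken_right (A : Fml σ) : Prov σ Γ Δ → Prov σ Γ (A ::ₘ Δ) :=
  fun ⟨_, ⟨p⟩⟩ => ⟨_, ⟨.rw A p⟩⟩

theorem of_mem {A : Fml σ} (hΓ : A ∈ Γ) (hΔ : A ∈ Δ) : Prov σ Γ Δ := by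
  obtain ⟨Γ, rfl⟩ := Multiset.exists_cons_of_mem hΓ
  obtain ⟨Δ, rfl⟩ := Multiset.exists_cons_of_mem hΔ
  induction Γ using Multiset.induction_on with
  | empty =>
    induction Δ using Multiset.induction_on with
    | empty => exact ⟨1, ⟨.ax A⟩⟩
    | cons B Δ ih =>
      rw [Multiset.cons_swap]
      exact (ih (by simp)).weaken_right B
  | cons B Γ ih =>
    rw [Multiset.cons_swap]
    exact (ih (by simp)).weaken_left B

theorem contract_left {A : Fml σ} (hA : A ∈ Γ) (h : Prov σ (A ::ₘ Γ) Δ) : Prov σ Γ Δ := by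
  obtain ⟨Γ, rfl⟩ := Multiset.exists_cons_of_mem hA
  obtain ⟨_, ⟨p⟩⟩ := h
  exact ⟨_, ⟨.lc A p⟩⟩

theorem eq_refl (t : Tm σ) (h : Fml.eq t t ∈ Δ) : Prov σ Γ Δ := by
  obtain ⟨_, ⟨p⟩⟩ := of_mem (Multiset.mem_cons_self (Fml.eq t t) Γ) h
  exact ⟨_, ⟨.eqE t p⟩⟩

theorem ex_left (A : Fml σ)
    (h : ∀ a, Prov σ (.ext (.par a) ::ₘ A.inst0 (.par a) ::ₘ Γ) Δ) :
    Prov σ (A.ex ::ₘ Γ) Δ := by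
  obtain ⟨a, ha⟩ := exists_freshM (A ::ₘ (Γ + Δ))
  obtain ⟨_, ⟨p⟩⟩ := h a
  exact ⟨_, ⟨.lex A a (fun B hB => ha B (by simp [hB])) (fun B hB => ha B (by simp [hB]))
    (ha A (by simp)) p⟩⟩

theorem ex_right (A : Fml σ) (t : Tm σ) (ht : .ext t ∈ Γ) (h : Prov σ Γ (A.inst0 t ::ₘ Δ)) :
    Prov σ Γ (A.ex ::ₘ Δ) := by
  obtain ⟨_, ⟨p⟩⟩ := h
  exact contract_left ht ⟨_, ⟨.rex A t p⟩⟩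

theorem iq_right (F G : Fml σ) (t : Tm σ)
    (hF : Prov σ Γ (F.inst0 t ::ₘ Δ)) (hG : Prov σ Γ (G.inst0 t ::ₘ Δ))
    (ht : Prov σ Γ (.ext t ::ₘ Δ))
    (huniq : ∀ a, Prov σ (.ext (.par a) ::ₘ F.inst0 (.par a) ::ₘ Γ) (.eq (.par a) t ::ₘ Δ)) :
    Prov σ Γ (F.iq G ::ₘ Δ) := by
  obtain ⟨a, ha⟩ := exists_freshM (F ::ₘ G ::ₘ (Γ + Δ))
  obtain ⟨_, ⟨p₁⟩⟩ := hF
  obtain ⟨_, ⟨p₂⟩⟩ := hG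
  obtain ⟨_, ⟨p₃⟩⟩ := ht
  obtain ⟨_, ⟨p₄⟩⟩ := huniq a
  exact ⟨_, ⟨.ri F G t a (fun B hB => ha B (by simp [hB])) (fun B hB => ha B (by simp [hB]))
    (ha F (by simp)) (ha G (by simp)) p₁ p₂ p₃ p₄⟩⟩

theorem iq_exG_left_atomic {F : Fml σ} (A : Fml σ) (t₁ t₂ : Tm σ) (hA : A.Atomic)
    (hI : F.iq .exG ∈ Γ)
    (hF₁ : Prov σ Γ (F.inst0 t₁ ::ₘ Δ)) (hF₂ : Prov σ Γ (F.inst0 t₂ ::ₘ Δ))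
    (ht₁ : Prov σ Γ (.ext t₁ ::ₘ Δ)) (ht₂ : Prov σ Γ (.ext t₂ ::ₘ Δ))
    (h : Prov σ Γ (A.inst0 t₂ ::ₘ Δ)) : Prov σ Γ (A.inst0 t₁ ::ₘ Δ) := by
  obtain ⟨_, ⟨p₁⟩⟩ := hF₁
  obtain ⟨_, ⟨p₂⟩⟩ := hF₂
  obtain ⟨_, ⟨p₃⟩⟩ := ht₁
  obtain ⟨_, ⟨p₄⟩⟩ := ht₂
  obtain ⟨_, ⟨p₅⟩⟩ := h
  exact contract_left hI ⟨_, ⟨.li2 F A t₁ t₂ hA p₁ p₂ p₃ p₄ p₅⟩⟩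

theorem iq_exG_left {F : Fml σ} (hI : F.iq .exG ∈ Γ)
    (h : ∀ a, Prov σ (F.inst0 (.par a) ::ₘ .ext (.par a) ::ₘ Γ) Δ) : Prov σ Γ Δ := by
  obtain ⟨a, ha⟩ := exists_freshM (F ::ₘ (Γ + Δ))
  obtain ⟨_, ⟨p⟩⟩ := h a
  exact contract_left hI ⟨_, ⟨.li3 F a (fun B hB => ha B (by simp [hB]))
    (fun B hB => ha B (by simp [hB])) (ha F (by simp)) p⟩⟩

theorem iq_eqG_left_atomic {F : Fml σ} (A : Fml σ) (t₁ t₂ : Tm σ) (hA : A.Atomic)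
    (hI : F.iq (.eqG t₂) ∈ Γ)
    (hF : Prov σ Γ (F.inst0 t₁ ::ₘ Δ))
    (ht₁ : Prov σ Γ (.ext t₁ ::ₘ Δ)) (ht₂ : Prov σ Γ (.ext t₂ ::ₘ Δ))
    (h : Prov σ Γ (A.inst0 t₂ ::ₘ Δ)) : Prov σ Γ (A.inst0 t₁ ::ₘ Δ) := by
  obtain ⟨_, ⟨p₁⟩⟩ := hF
  obtain ⟨_, ⟨p₂⟩⟩ := ht₁
  obtain ⟨_, ⟨p₃⟩⟩ := ht₂
  obtain ⟨_, ⟨p₄⟩⟩ := h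
  exact contract_left hI ⟨_, ⟨.li4 F A t₁ t₂ hA p₁ p₂ p₃ p₄⟩⟩

theorem iq_eqG_left {F : Fml σ} (t : Tm σ) (hI : F.iq (.eqG t) ∈ Γ)
    (ht : Prov σ Γ (.ext t ::ₘ Δ))
    (h : ∀ a, Prov σ (F.inst0 (.par a) ::ₘ .ext (.par a) ::ₘ Γ) Δ) : Prov σ Γ Δ := by
  obtain ⟨a, ha⟩ := exists_freshM (F ::ₘ .ext t ::ₘ (Γ + Δ))
  obtain ⟨_, ⟨p⟩⟩ := ht
  obtain ⟨_, ⟨q⟩⟩ := h a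
  exact contract_left hI ⟨_, ⟨.li5 F t a (fun B hB => ha B (by simp [hB]))
    (fun B hB => ha B (by simp [hB])) (ha F (by simp)) (ha (.ext t) (by simp)) p q⟩⟩

end Prov

theorem inst0_exIdF_body {σ : Sig} (F : Fml σ) (c : ℕ) :
    (Fml.iq (F.lift 1) (Fml.eq (.bvar 0) (.bvar 1))).inst0 (.par c) =
      F.iq (.eqG (.par c)) := by
  simp [Fml.inst0, Fml.inst, Fml.inst_lift, Tm.inst, Tm.lift]

theorem prov_the_F_exists_of_exists_identical {σ : Sig} (F : Fml σ) :
    Prov σ {exIdF F} {F.iq .exG} := by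
  refine Prov.ex_left (Γ := 0) _ fun c => ?_
  rw [inst0_exIdF_body]
  refine Prov.iq_eqG_left (F := F) (.par c) (by simp)
    (.of_mem (A := .ext (.par c)) (by simp) (by simp)) fun a => ?_
  refine Prov.iq_right (Δ := 0) F .exG (.par a)
    (.of_mem (A := F.inst0 (.par a)) (by simp) (by simp))
    (.of_mem (A := .ext (.par a)) (by simp) (Multiset.mem_cons_self _ _))
    (.of_mem (A := .ext (.par a)) (by simp) (by simp)) fun d => ?_
  refine Prov.iq_eqG_left_atomic (F := F) (.eq (.bvar 0) (.par a)) (.par d) (.par c) trivial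
    (by simp) (.of_mem (A := F.inst0 (.par d)) (by simp) (by simp))
    (.of_mem (A := .ext (.par d)) (by simp) (by simp))
    (.of_mem (A := .ext (.par c)) (by simp) (by simp)) ?_
  exact Prov.iq_eqG_left_atomic (F := F) (.eq (.par c) (.bvar 0)) (.par a) (.par c) trivial
    (by simp) (.of_mem (A := F.inst0 (.par a)) (by simp) (by simp))
    (.of_mem (A := .ext (.par a)) (by simp) (by simp))
    (.of_mem (A := .ext (.par c)) (by simp) (by simp))
    (.eq_refl (.par c) (Multiset.mem_cons_self _ _))

theorem prov_exists_identical_of_the_F_exists {σ : Sig} (F : Fml σ) :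
    Prov σ {F.iq .exG} {exIdF F} := by
  refine Prov.iq_exG_left (F := F) (by simp) fun a => ?_
  refine Prov.ex_right (Δ := 0) _ (.par a) (by simp) ?_
  rw [inst0_exIdF_body]
  refine Prov.iq_right F (.eqG (.par a)) (.par a)
    (.of_mem (A := F.inst0 (.par a)) (by simp) (by simp))
    (.eq_refl (.par a) (Multiset.mem_cons_self _ _))
    (.of_mem (A := .ext (.par a)) (by simp) (by simp)) fun d => ?_
  exact Prov.iq_exG_left_atomic (F := F) (.eq (.bvar 0) (.par a)) (.par d) (.par a) trivial
    (by simp) (.of_mem (A := F.inst0 (.par d)) (by simp) (by simp))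
    (.of_mem (A := F.inst0 (.par a)) (by simp) (by simp))
    (.of_mem (A := .ext (.par d)) (by simp) (by simp))
    (.of_mem (A := .ext (.par a)) (by simp) (by simp))
    (.eq_refl (.par a) (Multiset.mem_cons_self _ _))

/-- For every formula `F`, the sequents `∃y Ix[F, x = y] ⇒ Ix[F, ∃!x]` and
`Ix[F, ∃!x] ⇒ ∃y Ix[F, x = y]` are both provable in GPFL=^I: "something is
identical to the F" is equivalent to "the F exists". -/
theorem exists_identical_iff_the_F_exists {σ : Sig} (F : Fml σ) :
    Prov σ {exIdF F} {Fml.iq F Fml.exG} ∧ Prov σ {Fml.iq F Fml.exG} {exIdF F} :=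
  ⟨prov_the_F_exists_of_exists_identical F, prov_exists_identical_of_the_F_exists F⟩
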